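/- arXiv:0810.4377 — 10 statements merged into one kernel-verified Lean document; each statement's English description precedes it below -/
import Mathlib

section
/- Let V be an ℓ-Volterra QSO with associated coefficients a_{ki}. Suppose there exists k₀ ∈ {1,...,ℓ} such that a_{k₀ i} ≤ 0 for every i ∈ E, and let p = (p_1,...,p_ℓ) ∈ P_0, i.e. p ∈ S^{ℓ-1} with Σ_{k=1}^ℓ a_{ki} p_k ≤ 0 for every i ∈ E. Then the function φ_p(x) = x_1^{p_1} ⋯ x_ℓ^{p_ℓ} satisfies φ_p(V(x)) ≤ φ_p(x) for every x ∈ int S^{m-1}; consequently, along any trajectory x^{(n+1)} = V(x^{(n)}) with x^{(0)} ∈ int S^{m-1} remaining in int S^{m-1}, the limit lim_{n→∞} φ_p(x^{(n)}) exists (φ_p is a Lyapunov function). -/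
open Finset Filter Topology

/-- The quadratic stochastic operator determined by the cubic matrix `P`. -/
def QSOmap (m : ℕ) (P : Fin m → Fin m → Fin m → ℝ) (x : Fin m → ℝ) : Fin m → ℝ :=
  fun k => ∑ i, ∑ j, P i j k * x i * x j

/-- Conditions on the heredity coefficients of a quadratic stochastic operator. -/
def IsQSO (m : ℕ) (P : Fin m → Fin m → Fin m → ℝ) : Prop :=
  (∀ i j k, 0 ≤ P i j k) ∧ (∀ i j k, P i j k = P j i k) ∧ (∀ i j, ∑ k, P i j k = 1)

/-- Membership in the simplex `S^{m-1}`. -/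
def InSimplex (m : ℕ) (x : Fin m → ℝ) : Prop :=
  (∀ i, 0 ≤ x i) ∧ ∑ i, x i = 1

/-- Membership in the interior of the simplex `S^{m-1}`. -/
def InIntSimplex (m : ℕ) (x : Fin m → ℝ) : Prop :=
  (∀ i, 0 < x i) ∧ ∑ i, x i = 1

/-- The coefficients `P` define an `ℓ`-Volterra QSO (indices `0,...,ℓ-1` play the
role of `1,...,ℓ`). -/
def IsLVolterra (m ℓ : ℕ) (P : Fin m → Fin m → Fin m → ℝ) : Prop :=
  IsQSO m P ∧
  (∀ i j k : Fin m, (k : ℕ) < ℓ → k ≠ i → k ≠ j → P i j k = 0) ∧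
  (∀ k : Fin m, ℓ ≤ (k : ℕ) → ∃ i j : Fin m, i ≠ k ∧ j ≠ k ∧ 0 < P i j k)

/-- The numbers `a_{ki}`: `a_{ki} = 2 P_{ik,k} - 1` for `i ≠ k` and `a_{kk} = P_{kk,k} - 1`. -/
def aCoef (m : ℕ) (P : Fin m → Fin m → Fin m → ℝ) (k i : Fin m) : ℝ :=
  if i = k then P k k k - 1 else 2 * P i k k - 1

theorem qso_eq (m ℓ : ℕ) (P : Fin m → Fin m → Fin m → ℝ) (hV : IsLVolterra m ℓ P)
    (x : Fin m → ℝ) (k : Fin m) (hk : (k : ℕ) < ℓ) :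
    QSOmap m P x k = (∑ i, (aCoef m P k i + 1) * x i) * x k := by
  obtain ⟨⟨_, hs, _⟩, hz, _⟩ := hV
  have h1 : ∀ i j, P i j k * x i * x j = (if i = k then P k j k * x k * x j else 0) +
      (if j = k then (if i = k then 0 else P i k k * x i * x k) else 0) := by
    intro i j
    by_cases hi : i = k
    · subst hi; simp
    · by_cases hj : j = k
      · subst hj; simp [hi]
      · simp [hi, hj, hz i j k hk (Ne.symm hi) (Ne.symm hj)]
  have h2 : ∀ i, ∑ j, P i j k * x i * x j = (if i = k then ∑ j, P k j k * x k * x j else 0) +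
      (if i = k then 0 else P i k k * x i * x k) := by
    intro i
    rw [Finset.sum_congr rfl (fun j _ => h1 i j), Finset.sum_add_distrib]
    congr 1
    · split_ifs <;> simp
    · simp
  unfold QSOmap
  rw [Finset.sum_congr rfl (fun i _ => h2 i), Finset.sum_add_distrib,
    Finset.sum_ite_eq' Finset.univ k, if_pos (Finset.mem_univ k), ← Finset.sum_add_distrib,
    Finset.sum_mul]
  refine Finset.sum_congr rfl fun i _ => ?_
  unfold aCoef
  by_cases hi : i = k
  · subst hi; simp
  · simp only [hi, if_false]
    rw [hs k i k]; ring

/-- Theorem 1: `φ_p(x) = x_1^{p_1} ⋯ x_ℓ^{p_ℓ}` is a Lyapunov function. -/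
theorem phi_p_Lyapunov (m ℓ : ℕ) (hℓ1 : 1 ≤ ℓ) (hℓm : ℓ ≤ m)
    (P : Fin m → Fin m → Fin m → ℝ) (hV : IsLVolterra m ℓ P)
    (k₀ : Fin m) (hk₀ : (k₀ : ℕ) < ℓ)
    (ha : ∀ i : Fin m, aCoef m P k₀ i ≤ 0)
    (p : Fin ℓ → ℝ) (hp0 : ∀ k, 0 ≤ p k) (hp1 : ∑ k, p k = 1)
    (hpP0 : ∀ i : Fin m, ∑ k : Fin ℓ, aCoef m P (Fin.castLE hℓm k) i * p k ≤ 0) :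
    (∀ x : Fin m → ℝ, InIntSimplex m x →
      (∏ k : Fin ℓ, (QSOmap m P x (Fin.castLE hℓm k)) ^ (p k)) ≤
        ∏ k : Fin ℓ, (x (Fin.castLE hℓm k)) ^ (p k)) ∧
    (∀ traj : ℕ → (Fin m → ℝ), (∀ n, traj (n + 1) = QSOmap m P (traj n)) →
      InIntSimplex m (traj 0) → (∀ n, InIntSimplex m (traj n)) →
      ∃ c : ℝ, Tendsto (fun n => ∏ k : Fin ℓ, (traj n (Fin.castLE hℓm k)) ^ (p k))
        atTop (𝓝 c)) := by
  have hP0 := hV.1.1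
  have key : ∀ x : Fin m → ℝ, InIntSimplex m x →
      (∏ k : Fin ℓ, (QSOmap m P x (Fin.castLE hℓm k)) ^ (p k)) ≤
        ∏ k : Fin ℓ, (x (Fin.castLE hℓm k)) ^ (p k) := by
    intro x ⟨hx, hx1⟩
    have hy : ∀ k : Fin m, 0 ≤ ∑ i, (aCoef m P k i + 1) * x i := by
      intro k
      refine Finset.sum_nonneg fun i _ => mul_nonneg ?_ (hx i).le
      unfold aCoef
      split_ifs
      · linarith [hP0 k k k]
      · linarith [hP0 i k k]
    have hq : ∀ k : Fin ℓ, (QSOmap m P x (Fin.castLE hℓm k)) ^ (p k) =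
        (∑ i, (aCoef m P (Fin.castLE hℓm k) i + 1) * x i) ^ (p k) *
          (x (Fin.castLE hℓm k)) ^ (p k) := by
      intro k
      rw [qso_eq m ℓ P hV x _ (by simp), Real.mul_rpow (hy _) (hx _).le]
    rw [Finset.prod_congr rfl (fun k _ => hq k), Finset.prod_mul_distrib]
    refine mul_le_of_le_one_left
      (Finset.prod_nonneg fun k _ => Real.rpow_nonneg (hx _).le _) ?_
    refine (Real.geom_mean_le_arith_mean_weighted Finset.univ p _ (fun k _ => hp0 k) hp1
      (fun k _ => hy (Fin.castLE hℓm k))).trans ?_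
    have : ∑ k : Fin ℓ, p k * ∑ i, (aCoef m P (Fin.castLE hℓm k) i + 1) * x i =
        ∑ i, (∑ k : Fin ℓ, aCoef m P (Fin.castLE hℓm k) i * p k + 1) * x i := by
      simp_rw [Finset.mul_sum]
      rw [Finset.sum_comm]
      refine Finset.sum_congr rfl fun i _ => ?_
      rw [← hp1, ← Finset.sum_add_distrib, Finset.sum_mul]
      exact Finset.sum_congr rfl fun k _ => by rw [hp1]; ring
    rw [this, ← hx1]
    refine Finset.sum_le_sum fun i _ => ?_
    nlinarith [hpP0 i, hx i]
  refine ⟨key, fun traj ht _ hint => ?_⟩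
  refine ⟨_, tendsto_atTop_ciInf (antitone_nat_of_succ_le fun n => ?_) ⟨0, ?_⟩⟩
  · rw [ht n]; exact key _ (hint n)
  · rintro _ ⟨n, rfl⟩
    exact Finset.prod_nonneg fun k _ => Real.rpow_nonneg ((hint n).1 _).le _
end

section
/- Let V be an ℓ-Volterra QSO with associated coefficients a_{ki}, let r ≤ ℓ, and suppose a_{ki} < 0 for all k ∈ {1,...,r} and i ∈ {r+1,...,m}. Set α = min{ −a_{ki} : 1 ≤ k ≤ r, r+1 ≤ i ≤ m } > 0 and φ(x) = x_1 + ⋯ + x_r. Then for every x ∈ S^{m-1}, φ(V(x)) ≤ φ(x)[1 − α + α φ(x)]. -/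
open Finset Filter Topology

/-- `φ(x) = x_1 + ⋯ + x_r` (sum of the first `r` coordinates). -/
def phiSum (m r : ℕ) (x : Fin m → ℝ) : ℝ :=
  ∑ k ∈ Finset.univ.filter (fun k : Fin m => (k : ℕ) < r), x k

/-- Theorem 2, inequality (13): `φ(V(x)) ≤ φ(x)[1 - α + α φ(x)]`. -/
theorem phi_decreasing_estimate (m ℓ r : ℕ) (hℓ1 : 1 ≤ ℓ) (hℓm : ℓ ≤ m)
    (hr1 : 1 ≤ r) (hrℓ : r ≤ ℓ) (hrm : r < m)
    (P : Fin m → Fin m → Fin m → ℝ) (hV : IsLVolterra m ℓ P)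
    (ha : ∀ k i : Fin m, (k : ℕ) < r → r ≤ (i : ℕ) → aCoef m P k i < 0)
    (α : ℝ)
    (hαmem : ∃ k i : Fin m, (k : ℕ) < r ∧ r ≤ (i : ℕ) ∧ α = -aCoef m P k i)
    (hαmin : ∀ k i : Fin m, (k : ℕ) < r → r ≤ (i : ℕ) → α ≤ -aCoef m P k i)
    (x : Fin m → ℝ) (hx : InSimplex m x) :
    0 < α ∧
    phiSum m r (QSOmap m P x) ≤ phiSum m r x * (1 - α + α * phiSum m r x) := by
  obtain ⟨⟨hP0, hPs, hP1⟩, hVol, -⟩ := hV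
  obtain ⟨hx0, hx1⟩ := hx
  refine ⟨?_, ?_⟩
  · obtain ⟨k, i, hk, hi, rfl⟩ := hαmem
    linarith [ha k i hk hi]
  let χ : Fin m → ℝ := fun i => if (i : ℕ) < r then 1 else 0
  have hφ : phiSum m r x = ∑ i, χ i * x i := by
    simp [phiSum, χ, Finset.sum_filter]
  have hψ : ∑ i, (1 - χ i) * x i = 1 - phiSum m r x := by
    rw [hφ]
    simp only [sub_mul, one_mul, Finset.sum_sub_distrib, hx1]
  have hmix : ∀ i j : Fin m, (i : ℕ) < r → ¬ (j : ℕ) < r →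
      ∑ k ∈ Finset.univ.filter (fun k : Fin m => (k : ℕ) < r), P i j k ≤ (1 - α) / 2 := by
    intro i j hi hj
    rw [Finset.sum_eq_single i]
    · have h := hαmin i j hi (not_lt.mp hj)
      have hne : j ≠ i := by rintro rfl; exact hj hi
      rw [aCoef, if_neg hne] at h
      rw [hPs i j i]
      linarith
    · intro k hk hki
      have hk' : (k : ℕ) < r := (Finset.mem_filter.mp hk).2
      exact hVol i j k (by omega) hki (by rintro rfl; exact hj hk')
    · intro h
      exact absurd (Finset.mem_filter.mpr ⟨Finset.mem_univ i, hi⟩) h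
  have hQ : ∀ i j : Fin m,
      ∑ k ∈ Finset.univ.filter (fun k : Fin m => (k : ℕ) < r), P i j k ≤
        χ i * χ j + (1 - α) / 2 * (χ i * (1 - χ j) + (1 - χ i) * χ j) := by
    intro i j
    by_cases hi : (i : ℕ) < r <;> by_cases hj : (j : ℕ) < r
    · simp only [χ, if_pos hi, if_pos hj]
      have : ∑ k ∈ Finset.univ.filter (fun k : Fin m => (k : ℕ) < r), P i j k ≤ ∑ k, P i j k :=
        Finset.sum_le_sum_of_subset_of_nonneg (Finset.filter_subset _ _) (fun k _ _ => hP0 i j k)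
      rw [hP1] at this
      linarith
    · simp only [χ, if_pos hi, if_neg hj]
      linarith [hmix i j hi hj]
    · simp only [χ, if_neg hi, if_pos hj]
      have h := hmix j i hj hi
      rw [Finset.sum_congr rfl (fun k _ => hPs j i k)] at h
      linarith
    · simp only [χ, if_neg hi, if_neg hj]
      rw [Finset.sum_eq_zero]
      · simp
      intro k hk
      have hk' : (k : ℕ) < r := (Finset.mem_filter.mp hk).2
      exact hVol i j k (by omega) (by rintro rfl; exact hi hk') (by rintro rfl; exact hj hk')
  have hL : phiSum m r (QSOmap m P x) = ∑ i, ∑ j,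
      (∑ k ∈ Finset.univ.filter (fun k : Fin m => (k : ℕ) < r), P i j k) * (x i * x j) := by
    unfold phiSum QSOmap
    rw [Finset.sum_comm]
    refine Finset.sum_congr rfl (fun i _ => ?_)
    rw [Finset.sum_comm]
    refine Finset.sum_congr rfl (fun j _ => ?_)
    rw [Finset.sum_mul]
    exact Finset.sum_congr rfl (fun k _ => by ring)
  have hR : ∑ i, ∑ j, (χ i * χ j + (1 - α) / 2 * (χ i * (1 - χ j) + (1 - χ i) * χ j)) * (x i * x j)
      = (∑ i, χ i * x i) * (∑ i, χ i * x i) + (1 - α) / 2 *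
        ((∑ i, χ i * x i) * (∑ i, (1 - χ i) * x i)
          + (∑ i, (1 - χ i) * x i) * (∑ i, χ i * x i)) := by
    simp only [Finset.sum_mul_sum]
    simp only [← Finset.sum_add_distrib, Finset.mul_sum]
    exact Finset.sum_congr rfl (fun i _ => Finset.sum_congr rfl (fun j _ => by ring))
  rw [hL]
  calc _ ≤ _ := Finset.sum_le_sum (fun i _ => Finset.sum_le_sum (fun j _ =>
          mul_le_mul_of_nonneg_right (hQ i j) (mul_nonneg (hx0 i) (hx0 j))))
    _ = _ := hR
    _ = _ := by rw [hψ, ← hφ]; ring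
end

section
/- Let V be an ℓ-Volterra QSO with associated coefficients a_{ki}, let r ≤ ℓ, suppose a_{ki} < 0 for all k ∈ {1,...,r} and i ∈ {r+1,...,m}, and set α = min{ −a_{ki} : 1 ≤ k ≤ r, r+1 ≤ i ≤ m } and φ(x) = x_1 + ⋯ + x_r. Then for any trajectory x^{(n+1)} = V(x^{(n)}) with x^{(0)} ∈ int S^{m-1}, one has φ(x^{(n)}) ≤ φ(x^{(0)}) [1 − α + α φ(x^{(0)})]^n for all n ≥ 0; in particular φ(x^{(n)}) → 0 as n → ∞ and the series Σ_{n=0}^∞ φ(x^{(n)}) converges. -/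
open Finset Filter Topology

theorem simplex_step (m : ℕ) (P : Fin m → Fin m → Fin m → ℝ) (hV : IsQSO m P)
    (x : Fin m → ℝ) (hx : InSimplex m x) : InSimplex m (QSOmap m P x) := by
  obtain ⟨h1, h2, h3⟩ := hV
  obtain ⟨hx0, hx1⟩ := hx
  refine ⟨fun k => Finset.sum_nonneg fun i _ => Finset.sum_nonneg fun j _ =>
    mul_nonneg (mul_nonneg (h1 i j k) (hx0 i)) (hx0 j), ?_⟩
  unfold QSOmap
  rw [Finset.sum_comm]
  have : ∀ i, ∑ k, ∑ j, P i j k * x i * x j = x i := by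
    intro i
    rw [Finset.sum_comm]
    have : ∀ j, ∑ k, P i j k * x i * x j = x i * x j := by
      intro j
      rw [← Finset.sum_mul, ← Finset.sum_mul, h3, one_mul]
    simp only [this]
    rw [← Finset.mul_sum, hx1, mul_one]
  simp only [this, hx1]

theorem phi_step (m ℓ r : ℕ) (hrℓ : r ≤ ℓ)
    (P : Fin m → Fin m → Fin m → ℝ) (hV : IsLVolterra m ℓ P) (α : ℝ)
    (hαmin : ∀ k i : Fin m, (k : ℕ) < r → r ≤ (i : ℕ) → α ≤ -aCoef m P k i)
    (x : Fin m → ℝ) (hx : InSimplex m x) :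
    phiSum m r (QSOmap m P x) ≤ phiSum m r x * (1 - α + α * phiSum m r x) := by
  obtain ⟨⟨h1, h2, h3⟩, h4, -⟩ := hV
  obtain ⟨hx0, hx1⟩ := hx
  have hmix : ∀ i j : Fin m, (i : ℕ) < r → r ≤ (j : ℕ) →
      ∑ k ∈ Finset.univ.filter (fun k : Fin m => (k : ℕ) < r), P i j k ≤ (1 - α) / 2 := by
    intro i j hi hj
    rw [Finset.sum_eq_single_of_mem i (by simp [hi])]
    · have := hαmin i j hi hj
      have hne : j ≠ i := by rintro rfl; omega
      rw [aCoef, if_neg hne, h2 j i i] at this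
      linarith
    · intro k hk hki
      have hk' : (k : ℕ) < r := by simpa using hk
      exact h4 i j k (by omega) hki (by rintro rfl; omega)
  let u : Fin m → ℝ := fun i => if (i : ℕ) < r then 1 else 0
  have hQ : ∀ i j : Fin m,
      ∑ k ∈ Finset.univ.filter (fun k : Fin m => (k : ℕ) < r), P i j k ≤
        u i * u j + (1 - α) / 2 * (u i * (1 - u j) + u j * (1 - u i)) := by
    intro i j
    by_cases hi : (i : ℕ) < r <;> by_cases hj : (j : ℕ) < r
    · simp only [u, hi, hj, if_true]
      have : ∑ k ∈ Finset.univ.filter (fun k : Fin m => (k : ℕ) < r), P i j k ≤ ∑ k, P i j k :=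
        Finset.sum_le_sum_of_subset_of_nonneg (Finset.filter_subset _ _)
          (fun k _ _ => h1 i j k)
      rw [h3] at this
      linarith
    · simp only [u, hi, hj, if_true, if_false]
      have := hmix i j hi (by omega)
      linarith
    · simp only [u, hi, hj, if_true, if_false]
      have := hmix j i hj (by omega)
      simp only [h2 j i] at this
      linarith
    · simp only [u, hi, hj, if_false]
      rw [Finset.sum_eq_zero]
      · simp
      · intro k hk
        have hk' : (k : ℕ) < r := by simpa using hk
        exact h4 i j k (by omega) (by rintro rfl; omega) (by rintro rfl; omega)
  have hphi : phiSum m r x = ∑ i, u i * x i := by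
    simp [phiSum, u, Finset.sum_filter]
  have hL : phiSum m r (QSOmap m P x) = ∑ i, ∑ j,
      (∑ k ∈ Finset.univ.filter (fun k : Fin m => (k : ℕ) < r), P i j k) * x i * x j := by
    unfold phiSum QSOmap
    rw [Finset.sum_comm]
    refine Finset.sum_congr rfl fun i _ => ?_
    rw [Finset.sum_comm]
    refine Finset.sum_congr rfl fun j _ => ?_
    rw [Finset.sum_mul, Finset.sum_mul]
  have hprod : ∀ f g : Fin m → ℝ, ∑ i, ∑ j, f i * g j = (∑ i, f i) * ∑ j, g j := by
    intro f g
    rw [Finset.sum_mul_sum]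
  have hR : ∑ i, ∑ j, (u i * u j + (1 - α) / 2 * (u i * (1 - u j) + u j * (1 - u i))) * x i * x j
      = phiSum m r x * (1 - α + α * phiSum m r x) := by
    have : ∀ i j, (u i * u j + (1 - α) / 2 * (u i * (1 - u j) + u j * (1 - u i))) * x i * x j
        = α * ((u i * x i) * (u j * x j)) + (1 - α) / 2 * ((u i * x i) * x j)
          + (1 - α) / 2 * (x i * (u j * x j)) := by
      intro i j; ring
    simp only [this, Finset.sum_add_distrib, ← Finset.mul_sum]
    simp only [← Finset.sum_mul, ← Finset.mul_sum, ← hphi, hx1]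
    ring
  rw [hL, ← hR]
  refine Finset.sum_le_sum fun i _ => Finset.sum_le_sum fun j _ => ?_
  exact mul_le_mul_of_nonneg_right (mul_le_mul_of_nonneg_right (hQ i j) (hx0 i)) (hx0 j)

/-- Theorem 2: along any trajectory starting in the interior of the simplex,
`φ(x^{(n)}) ≤ φ(x^{(0)})[1 - α + α φ(x^{(0)})]^n`, `φ(x^{(n)}) → 0` and
`Σ_n φ(x^{(n)}) < ∞`. -/
theorem phi_Lyapunov (m ℓ r : ℕ) (hℓ1 : 1 ≤ ℓ) (hℓm : ℓ ≤ m)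
    (hr1 : 1 ≤ r) (hrℓ : r ≤ ℓ) (hrm : r < m)
    (P : Fin m → Fin m → Fin m → ℝ) (hV : IsLVolterra m ℓ P)
    (ha : ∀ k i : Fin m, (k : ℕ) < r → r ≤ (i : ℕ) → aCoef m P k i < 0)
    (α : ℝ)
    (hαmem : ∃ k i : Fin m, (k : ℕ) < r ∧ r ≤ (i : ℕ) ∧ α = -aCoef m P k i)
    (hαmin : ∀ k i : Fin m, (k : ℕ) < r → r ≤ (i : ℕ) → α ≤ -aCoef m P k i)
    (traj : ℕ → (Fin m → ℝ)) (h0 : InIntSimplex m (traj 0))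
    (hstep : ∀ n, traj (n + 1) = QSOmap m P (traj n)) :
    (∀ n, phiSum m r (traj n) ≤
        phiSum m r (traj 0) * (1 - α + α * phiSum m r (traj 0)) ^ n) ∧
    Tendsto (fun n => phiSum m r (traj n)) atTop (𝓝 0) ∧
    Summable (fun n => phiSum m r (traj n)) := by
  have hS : ∀ n, InSimplex m (traj n) := by
    intro n
    induction n with
    | zero => exact ⟨fun i => (h0.1 i).le, h0.2⟩
    | succ n ih => rw [hstep]; exact simplex_step m P hV.1 _ ih
  have hnn : ∀ n, 0 ≤ phiSum m r (traj n) := fun n => Finset.sum_nonneg fun i _ => (hS n).1 i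
  have hα0 : 0 < α := by
    obtain ⟨k, i, hk, hi, rfl⟩ := hαmem
    have := ha k i hk hi
    linarith
  have hα1 : α ≤ 1 := by
    obtain ⟨k, i, hk, hi, rfl⟩ := hαmem
    have hne : i ≠ k := by rintro rfl; omega
    have := hV.1.1 i k k
    rw [aCoef, if_neg hne]
    linarith
  have hlt : phiSum m r (traj 0) < 1 := by
    rw [← h0.2]
    exact Finset.sum_lt_sum_of_subset (Finset.filter_subset _ _)
      (Finset.mem_univ (⟨r, hrm⟩ : Fin m)) (by simp) (h0.1 _) (fun j _ _ => (h0.1 j).le)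
  have hp0 := hnn 0
  have hst : ∀ n, phiSum m r (traj (n + 1)) ≤
      phiSum m r (traj n) * (1 - α + α * phiSum m r (traj n)) := by
    intro n
    rw [hstep]
    exact phi_step m ℓ r hrℓ P hV α hαmin _ (hS n)
  generalize hq : 1 - α + α * phiSum m r (traj 0) = q
  have hq0 : 0 ≤ q := by
    have := mul_nonneg hα0.le hp0
    linarith
  have hq1 : q < 1 := by nlinarith
  have hmain : ∀ n, phiSum m r (traj n) ≤ phiSum m r (traj 0) * q ^ n := by
    intro n
    induction n with
    | zero => simp
    | succ n ih =>
      have hle : phiSum m r (traj n) ≤ phiSum m r (traj 0) :=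
        ih.trans (mul_le_of_le_one_right hp0 (pow_le_one₀ hq0 hq1.le))
      have h2 : 1 - α + α * phiSum m r (traj n) ≤ q := by
        have := mul_le_mul_of_nonneg_left hle hα0.le
        linarith
      calc _ ≤ _ := hst n
        _ ≤ phiSum m r (traj n) * q := mul_le_mul_of_nonneg_left h2 (hnn n)
        _ ≤ phiSum m r (traj 0) * q ^ n * q := mul_le_mul_of_nonneg_right ih hq0
        _ = _ := by ring
  have hsum : Summable (fun n => phiSum m r (traj n)) :=
    Summable.of_nonneg_of_le hnn hmain ((summable_geometric_of_lt_one hq0 hq1).mul_left _)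
  exact ⟨hmain, hsum.tendsto_atTop_zero, hsum⟩
end

section
/- Let (a_n) and (b_n) be bounded sequences of nonnegative real numbers with a_{n+1} ≤ a_n + b_n for all n. If b_n → 0, then the set {a_n : n ∈ ℕ} is dense in the interval [lim inf a_n, lim sup a_n]. Moreover, if Σ_{n=1}^∞ b_n < +∞, then lim_{n→∞} a_n exists. -/
open Finset Filter Topology

/-- for bounded nonnegative sequences with `a_{n+1} ≤ a_n + b_n`:
if `b_n → 0` then `{a_n}` is dense in `[liminf a_n, limsup a_n]`; if `Σ b_n < ∞`
then `lim a_n` exists. -/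
theorem dense_or_convergent (a b : ℕ → ℝ)
    (ha0 : ∀ n, 0 ≤ a n) (hb0 : ∀ n, 0 ≤ b n)
    (haBdd : BddAbove (Set.range a)) (hbBdd : BddAbove (Set.range b))
    (hrec : ∀ n, a (n + 1) ≤ a n + b n) :
    (Tendsto b atTop (𝓝 0) →
      ∀ c ∈ Set.Icc (Filter.liminf a Filter.atTop) (Filter.limsup a Filter.atTop),
        c ∈ closure (Set.range a)) ∧
    (Summable b → ∃ L : ℝ, Tendsto a atTop (𝓝 L)) := by
  have hbu : IsBoundedUnder (· ≤ ·) atTop a := haBdd.isBoundedUnder_of_range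
  have hbl : IsBoundedUnder (· ≥ ·) atTop a := isBoundedUnder_of ⟨0, ha0⟩
  constructor
  · rintro hb c ⟨hc1, hc2⟩
    rw [Metric.mem_closure_range_iff]
    intro ε hε
    by_contra! hno
    have hgap : ∀ n, a n < c + ε → a n ≤ c - ε := by
      intro n hn
      have h := hno n
      rw [Real.dist_eq, le_abs] at h
      rcases h with h | h <;> linarith
    obtain ⟨N, hN⟩ := eventually_atTop.1 (hb.eventually (gt_mem_nhds hε))
    have hfr : ∃ᶠ n in atTop, a n < c + ε :=
      frequently_lt_of_liminf_lt hbu.isCoboundedUnder_ge (by linarith)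
    obtain ⟨n, hn, han⟩ := frequently_atTop.1 hfr N
    have hall : ∀ k, n ≤ k → a k ≤ c - ε := by
      intro k hk
      induction k, hk using Nat.le_induction with
      | base => exact hgap n han
      | succ k hk ih =>
        apply hgap
        have h1 := hrec k
        have h2 := hN k (le_trans hn hk)
        linarith
    have hls : limsup a atTop ≤ c - ε :=
      limsup_le_of_le hbl.isCoboundedUnder_le (eventually_atTop.2 ⟨n, hall⟩)
    linarith
  · intro hs
    have hanti : Antitone (fun n => a n - ∑ i ∈ Finset.range n, b i) := by
      apply antitone_nat_of_succ_le
      intro n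
      rw [Finset.sum_range_succ]
      have := hrec n
      linarith
    have hbd : BddBelow (Set.range (fun n => a n - ∑ i ∈ Finset.range n, b i)) := by
      refine ⟨-∑' i, b i, ?_⟩
      rintro _ ⟨n, rfl⟩
      have h1 := hs.sum_le_tsum (Finset.range n) (fun i _ => hb0 i)
      have h2 := ha0 n
      simp only
      linarith
    have h := (tendsto_atTop_ciInf hanti hbd).add hs.hasSum.tendsto_sum_nat
    exact ⟨_, h.congr (fun n => by ring)⟩
end

section
/- Let V be an ℓ-Volterra QSO with associated coefficients a_{ki}, let r ≤ ℓ, and suppose a_{ki} < 0 for all k ∈ {1,...,r} and i ∈ {r+1,...,m}. Then for any p = (p_1,...,p_r) ∈ S^{r-1}, the function ψ_p(x) = x_1^{p_1} ⋯ x_r^{p_r} is a Lyapunov function for V: along any trajectory x^{(n+1)} = V(x^{(n)}) with x^{(0)} ∈ int S^{m-1} remaining in int S^{m-1}, the limit lim_{n→∞} ψ_p(x^{(n)}) exists. -/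
open Finset Filter Topology

theorem step_le (m r ℓ : ℕ) (hrℓ : r ≤ ℓ) (P : Fin m → Fin m → Fin m → ℝ)
    (hV : IsLVolterra m ℓ P) (c : ℝ)
    (hc : ∀ k i : Fin m, (k : ℕ) < r → r ≤ (i : ℕ) → aCoef m P k i ≤ -c)
    (x : Fin m → ℝ) (hx : InIntSimplex m x) (u : Fin m → ℝ)
    (hu : u = fun i : Fin m => if (i : ℕ) < r then (1 : ℝ) else 0) :
    ∑ k, u k * QSOmap m P x k ≤
      (∑ k, u k * x k) - c * (∑ k, u k * x k) * (1 - ∑ k, u k * x k) := by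
  obtain ⟨⟨hP0, hPs, hP1⟩, hVol, -⟩ := hV
  obtain ⟨hx0, hx1⟩ := hx
  have hcase : ∀ i j : Fin m, (i : ℕ) < r → r ≤ (j : ℕ) →
      ∑ k, u k * P i j k ≤ (1 - c) / 2 := by
    intro i j hi hj
    have hne : j ≠ i := by
      intro h; subst h; omega
    rw [Finset.sum_eq_single i]
    · have h := hc i j hi hj
      simp only [aCoef, if_neg hne] at h
      rw [hPs i j i]
      simp only [hu, if_pos hi]
      linarith
    · intro k _ hk
      by_cases hkr : (k : ℕ) < r
      · rw [hVol i j k (by omega) hk (by intro h; subst h; omega), mul_zero]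
      · simp [hu, hkr]
    · simp
  have hQ : ∀ i j : Fin m, ∑ k, u k * P i j k ≤
      u i * u j + (1 - c) / 2 * (u i * (1 - u j) + (1 - u i) * u j) := by
    intro i j
    by_cases hi : (i : ℕ) < r <;> by_cases hj : (j : ℕ) < r
    · have h1 : ∑ k, u k * P i j k ≤ ∑ k, P i j k := by
        refine Finset.sum_le_sum fun k _ => ?_
        have := hP0 i j k
        simp only [hu]
        split_ifs <;> linarith
      rw [hP1] at h1
      have ei : u i = 1 := by simp [hu, hi]
      have ej : u j = 1 := by simp [hu, hj]
      rw [ei, ej]; linarith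
    · have ei : u i = 1 := by simp [hu, hi]
      have ej : u j = 0 := by simp [hu, hj]
      have := hcase i j hi (by omega)
      rw [ei, ej]; linarith
    · have ei : u i = 0 := by simp [hu, hi]
      have ej : u j = 1 := by simp [hu, hj]
      have := hcase j i hj (by omega)
      simp only [hPs j i] at this
      rw [ei, ej]; linarith
    · have ei : u i = 0 := by simp [hu, hi]
      have ej : u j = 0 := by simp [hu, hj]
      have : ∑ k, u k * P i j k = 0 := by
        refine Finset.sum_eq_zero fun k _ => ?_
        by_cases hkr : (k : ℕ) < r
        · rw [hVol i j k (by omega) (by intro h; subst h; omega)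
            (by intro h; subst h; omega), mul_zero]
        · simp [hu, hkr]
      rw [this, ei, ej]; simp
  have e1 : ∑ k, u k * QSOmap m P x k = ∑ i, ∑ j, (∑ k, u k * P i j k) * (x i * x j) := by
    simp only [QSOmap, Finset.mul_sum, Finset.sum_mul]
    rw [Finset.sum_comm]
    refine Finset.sum_congr rfl fun i _ => ?_
    rw [Finset.sum_comm]
    refine Finset.sum_congr rfl fun j _ => Finset.sum_congr rfl fun k _ => ?_
    ring
  have e2 : ∑ i, ∑ j, (u i * u j + (1 - c) / 2 * (u i * (1 - u j) + (1 - u i) * u j))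
      * (x i * x j) = c * ((∑ k, u k * x k) * (∑ k, u k * x k))
      + (1 - c) / 2 * ((∑ k, u k * x k) * (∑ k, x k))
      + (1 - c) / 2 * ((∑ k, x k) * (∑ k, u k * x k)) := by
    simp only [Finset.sum_mul_sum]
    simp only [Finset.mul_sum, ← Finset.sum_add_distrib]
    refine Finset.sum_congr rfl fun i _ => Finset.sum_congr rfl fun j _ => ?_
    ring
  rw [e1]
  calc _ ≤ ∑ i, ∑ j, (u i * u j + (1 - c) / 2 * (u i * (1 - u j) + (1 - u i) * u j))
      * (x i * x j) := by
        refine Finset.sum_le_sum fun i _ => Finset.sum_le_sum fun j _ => ?_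
        exact mul_le_mul_of_nonneg_right (hQ i j) (mul_pos (hx0 i) (hx0 j)).le
    _ = _ := by
        rw [e2, hx1]; ring

/-- Theorem 3: `ψ_p(x) = x_1^{p_1} ⋯ x_r^{p_r}` is a Lyapunov function. -/
theorem psi_p_Lyapunov (m ℓ r : ℕ) (hℓ1 : 1 ≤ ℓ) (hℓm : ℓ ≤ m)
    (hr1 : 1 ≤ r) (hrℓ : r ≤ ℓ) (hrm : r < m)
    (P : Fin m → Fin m → Fin m → ℝ) (hV : IsLVolterra m ℓ P)
    (ha : ∀ k i : Fin m, (k : ℕ) < r → r ≤ (i : ℕ) → aCoef m P k i < 0)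
    (p : Fin r → ℝ) (hp0 : ∀ k, 0 ≤ p k) (hp1 : ∑ k, p k = 1)
    (traj : ℕ → (Fin m → ℝ)) (hstep : ∀ n, traj (n + 1) = QSOmap m P (traj n))
    (h0 : InIntSimplex m (traj 0)) (hint : ∀ n, InIntSimplex m (traj n)) :
    ∃ c : ℝ, Tendsto
      (fun n => ∏ k : Fin r, (traj n (Fin.castLE (hrℓ.trans hℓm) k)) ^ (p k))
      atTop (𝓝 c) := by
  obtain ⟨c, hc0, hc⟩ : ∃ c : ℝ, 0 < c ∧ ∀ k i : Fin m, (k : ℕ) < r → r ≤ (i : ℕ) →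
      aCoef m P k i ≤ -c := by
    have hne : ((Finset.univ : Finset (Fin m × Fin m)).filter
        fun q => (q.1 : ℕ) < r ∧ r ≤ (q.2 : ℕ)).Nonempty :=
      ⟨(⟨0, by omega⟩, ⟨r, hrm⟩), by simp; omega⟩
    obtain ⟨q, hq, hmax⟩ := Finset.exists_max_image _ (fun q => aCoef m P q.1 q.2) hne
    simp only [Finset.mem_filter, Finset.mem_univ, true_and] at hq hmax
    refine ⟨-aCoef m P q.1 q.2, by linarith [ha q.1 q.2 hq.1 hq.2], fun k i hk hi => ?_⟩
    rw [neg_neg]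
    exact hmax (k, i) ⟨hk, hi⟩
  obtain ⟨u, hu⟩ : ∃ u : Fin m → ℝ, u = fun i : Fin m => if (i : ℕ) < r then (1 : ℝ) else 0 :=
    ⟨_, rfl⟩
  have hu0 : ∀ i, 0 ≤ u i := by
    intro i; simp only [hu]; split_ifs <;> norm_num
  obtain ⟨s, hs⟩ : ∃ s : ℕ → ℝ, s = fun n => ∑ k, u k * traj n k := ⟨_, rfl⟩
  have hs0 : ∀ n, 0 ≤ s n := by
    intro n; rw [hs]
    exact Finset.sum_nonneg fun k _ => mul_nonneg (hu0 k) ((hint n).1 k).le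
  have hs1 : ∀ n, s n < 1 := by
    intro n; rw [hs, ← (hint n).2]
    refine Finset.sum_lt_sum (fun k _ => ?_) ⟨⟨r, hrm⟩, Finset.mem_univ _, ?_⟩
    · have := (hint n).1 k
      simp only [hu]; split_ifs <;> linarith
    · have := (hint n).1 ⟨r, hrm⟩
      simpa [hu] using this
  have hst : ∀ n, s (n + 1) ≤ s n - c * s n * (1 - s n) := by
    intro n
    have := step_le m r ℓ hrℓ P hV c hc (traj n) (hint n) u hu
    rw [← hstep n] at this
    simpa only [hs] using this
  have hanti : Antitone s := by
    refine antitone_nat_of_succ_le fun n => ?_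
    have h1 : 0 ≤ c * s n * (1 - s n) :=
      mul_nonneg (mul_nonneg hc0.le (hs0 n)) (by linarith [hs1 n])
    linarith [hst n]
  have hbdd : BddBelow (Set.range s) := ⟨0, by rintro _ ⟨n, rfl⟩; exact hs0 n⟩
  obtain ⟨L, hL⟩ : ∃ L, Tendsto s atTop (𝓝 L) := ⟨_, tendsto_atTop_ciInf hanti hbdd⟩
  have hL0 : 0 ≤ L := ge_of_tendsto' hL hs0
  have hL1 : L < 1 := lt_of_le_of_lt (le_of_tendsto' hL fun n => hanti (Nat.zero_le n)) (hs1 0)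
  have hLL : L ≤ L - c * L * (1 - L) :=
    le_of_tendsto_of_tendsto' (hL.comp (tendsto_add_atTop_nat 1))
      (hL.sub ((hL.const_mul c).mul (hL.const_sub 1))) hst
  have hLz : L = 0 := by
    by_contra hne
    have hpos : 0 < L := lt_of_le_of_ne hL0 (Ne.symm hne)
    have : 0 < c * L * (1 - L) := mul_pos (mul_pos hc0 hpos) (by linarith)
    linarith
  rw [hLz] at hL
  refine ⟨0, squeeze_zero (fun n => ?_) (fun n => ?_) hL⟩
  · exact Finset.prod_nonneg fun k _ => Real.rpow_nonneg ((hint n).1 _).le _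
  · refine (Real.geom_mean_le_arith_mean_weighted Finset.univ p _ (fun k _ => hp0 k) hp1
      (fun k _ => ((hint n).1 _).le)).trans ?_
    have hle : ∀ k : Fin r, traj n (Fin.castLE (hrℓ.trans hℓm) k) ≤ s n := by
      intro k
      have h := Finset.single_le_sum (f := fun k => u k * traj n k)
        (fun k _ => mul_nonneg (hu0 k) ((hint n).1 k).le)
        (Finset.mem_univ (Fin.castLE (hrℓ.trans hℓm) k))
      have h1 : u (Fin.castLE (hrℓ.trans hℓm) k) = 1 := by simp [hu]
      simp only [h1, one_mul] at h
      simpa only [hs] using h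
    calc _ ≤ ∑ k, p k * s n :=
          Finset.sum_le_sum fun k _ => mul_le_mul_of_nonneg_left (hle k) (hp0 k)
      _ = s n := by rw [← Finset.sum_mul, hp1, one_mul]
end

section
/- Let V be an ℓ-Volterra QSO with associated coefficients a_{ki}. Suppose there exist p ∈ {1,...,ℓ} and q ∈ E such that a_{pi} − a_{qi} ≤ 0 for every i ∈ E. Then the function f_{pq}(x) = x_p / x_q satisfies f_{pq}(V(x)) ≤ f_{pq}(x) for every x ∈ int S^{m-1} with V(x) ∈ int S^{m-1}; consequently, along any trajectory x^{(n+1)} = V(x^{(n)}) remaining in int S^{m-1}, the sequence f_{pq}(x^{(n)}) is monotonically nonincreasing and lim_{n→∞} f_{pq}(x^{(n)}) exists. -/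
open Finset Filter Topology

theorem QSOmap_split (m : ℕ) (P : Fin m → Fin m → Fin m → ℝ) (hs : ∀ i j k, P i j k = P j i k)
    (x : Fin m → ℝ) (k : Fin m) :
    QSOmap m P x k = x k * ∑ i, (aCoef m P k i + 1) * x i +
      ∑ i, ∑ j, if k ≠ i ∧ k ≠ j then P i j k * x i * x j else 0 := by
  have h1 : ∀ i j, P i j k * x i * x j =
      (if i = k then P j k k * x k * x j else 0) +
      (if j = k then (if i = k then 0 else P i k k * x i * x k) else 0) +
      (if k ≠ i ∧ k ≠ j then P i j k * x i * x j else 0) := by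
    intro i j
    by_cases hi : i = k
    · subst hi
      simp [hs i j i]
    · by_cases hj : j = k
      · subst hj
        simp [hi]
      · simp [hi, hj, Ne.symm hi, Ne.symm hj]
  unfold QSOmap
  rw [Finset.sum_congr rfl fun i _ => Finset.sum_congr rfl fun j _ => h1 i j]
  simp only [Finset.sum_add_distrib]
  congr 1
  rw [Finset.sum_comm]
  simp only [Finset.sum_ite_eq', Finset.mem_univ, if_true]
  rw [← Finset.sum_add_distrib, Finset.mul_sum]
  refine Finset.sum_congr rfl fun i _ => ?_
  unfold aCoef
  split_ifs with h
  · subst h; ring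
  · ring

theorem fpq_step (m ℓ : ℕ) 
    (P : Fin m → Fin m → Fin m → ℝ) (hV : IsLVolterra m ℓ P)
    (p q : Fin m) (hp : (p : ℕ) < ℓ)
    (ha : ∀ i : Fin m, aCoef m P p i - aCoef m P q i ≤ 0)
    (x : Fin m → ℝ) (hx : InIntSimplex m x) (hVx : InIntSimplex m (QSOmap m P x)) :
      QSOmap m P x p / QSOmap m P x q ≤ x p / x q := by
  obtain ⟨⟨h0, hs, -⟩, hz, -⟩ := hV
  rw [div_le_div_iff₀ (hVx.1 q) (hx.1 q), QSOmap_split m P hs x p, QSOmap_split m P hs x q]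
  have e : (∑ i, ∑ j, if p ≠ i ∧ p ≠ j then P i j p * x i * x j else 0) = 0 := by
    refine Finset.sum_eq_zero fun i _ => Finset.sum_eq_zero fun j _ => ?_
    split_ifs with h
    · rw [hz i j p hp h.1 h.2]; ring
    · rfl
  have f : 0 ≤ (∑ i, ∑ j, if q ≠ i ∧ q ≠ j then P i j q * x i * x j else 0) := by
    refine Finset.sum_nonneg fun i _ => Finset.sum_nonneg fun j _ => ?_
    split_ifs with h
    · exact mul_nonneg (mul_nonneg (h0 _ _ _) (hx.1 i).le) (hx.1 j).le
    · exact le_rfl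
  have g : ∑ i, (aCoef m P p i + 1) * x i ≤ ∑ i, (aCoef m P q i + 1) * x i :=
    Finset.sum_le_sum fun i _ => mul_le_mul_of_nonneg_right (by linarith [ha i]) (hx.1 i).le
  rw [e]
  have h1 := mul_le_mul_of_nonneg_left g (mul_pos (hx.1 p) (hx.1 q)).le
  have h2 := mul_nonneg (hx.1 p).le f
  linarith

/-- Theorem 4: `f_{pq}(x) = x_p / x_q` is a Lyapunov function, monotonically
nonincreasing along trajectories in the interior of the simplex. -/
theorem fpq_Lyapunov (m ℓ : ℕ) (hℓ1 : 1 ≤ ℓ) (hℓm : ℓ ≤ m)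
    (P : Fin m → Fin m → Fin m → ℝ) (hV : IsLVolterra m ℓ P)
    (p q : Fin m) (hp : (p : ℕ) < ℓ)
    (ha : ∀ i : Fin m, aCoef m P p i - aCoef m P q i ≤ 0) :
    (∀ x : Fin m → ℝ, InIntSimplex m x → InIntSimplex m (QSOmap m P x) →
      QSOmap m P x p / QSOmap m P x q ≤ x p / x q) ∧
    (∀ traj : ℕ → (Fin m → ℝ), (∀ n, traj (n + 1) = QSOmap m P (traj n)) →
      (∀ n, InIntSimplex m (traj n)) →
      (∀ n, traj (n + 1) p / traj (n + 1) q ≤ traj n p / traj n q) ∧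
      ∃ c : ℝ, Tendsto (fun n => traj n p / traj n q) atTop (𝓝 c)) := by
  have key := fpq_step m ℓ P hV p q hp ha
  refine ⟨key, fun traj ht hi => ?_⟩
  have hm : ∀ n, traj (n + 1) p / traj (n + 1) q ≤ traj n p / traj n q := by
    intro n
    have h := hi (n + 1)
    rw [ht n] at h ⊢
    exact key _ (hi n) h
  refine ⟨hm, _, tendsto_atTop_ciInf (antitone_nat_of_succ_le hm) ⟨0, ?_⟩⟩
  rintro _ ⟨n, rfl⟩
  exact div_nonneg ((hi n).1 p).le ((hi n).1 q).le
end

section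
/- Let V be an ℓ-Volterra QSO with associated coefficients a_{ki}, let r ≤ ℓ, and suppose a_{ki} < 0 for all k ∈ {1,...,r} and i ∈ {r+1,...,m}. Then for every x^0 ∈ int S^{m-1}, every ω-limit point x* of the trajectory x^{(n+1)} = V(x^{(n)}) satisfies x*_1 = x*_2 = ⋯ = x*_r = 0; i.e. ω(x^0) is contained in the face of S^{m-1} spanned by the vertices e^{(r+1)},...,e^{(m)}. -/
open Finset Filter Topology

lemma qso_simplex (m : ℕ) (P : Fin m → Fin m → Fin m → ℝ) (hP : IsQSO m P) (x : Fin m → ℝ)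
    (hx : InSimplex m x) : InSimplex m (QSOmap m P x) := by
  obtain ⟨h1, h2, h3⟩ := hP
  obtain ⟨hx0, hx1⟩ := hx
  refine ⟨fun k => ?_, ?_⟩
  · exact Finset.sum_nonneg fun i _ => Finset.sum_nonneg fun j _ =>
      mul_nonneg (mul_nonneg (h1 i j k) (hx0 i)) (hx0 j)
  · unfold QSOmap
    rw [Finset.sum_comm]
    calc ∑ i, ∑ k, ∑ j, P i j k * x i * x j = ∑ i, ∑ j, x i * x j := by
          refine Finset.sum_congr rfl fun i _ => ?_
          rw [Finset.sum_comm]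
          refine Finset.sum_congr rfl fun j _ => ?_
          rw [← Finset.sum_mul, ← Finset.sum_mul, h3, one_mul]
      _ = 1 := by rw [← Finset.sum_mul_sum, hx1, one_mul]

/-- indicator of the first `r` indices -/
noncomputable def chi (m r : ℕ) (i : Fin m) : ℝ := if (i : ℕ) < r then 1 else 0

/-- total mass of the first `r` coordinates -/
noncomputable def mass (m r : ℕ) (x : Fin m → ℝ) : ℝ := ∑ i, chi m r i * x i

lemma exists_eps (m r : ℕ) (P : Fin m → Fin m → Fin m → ℝ)
    (ha : ∀ k i : Fin m, (k : ℕ) < r → r ≤ (i : ℕ) → aCoef m P k i < 0) :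
    ∃ ε : ℝ, 0 < ε ∧ ε ≤ 1 ∧ ∀ k i : Fin m, (k : ℕ) < r → r ≤ (i : ℕ) →
      2 * P i k k ≤ 1 - ε := by
  have h : ∀ᶠ ε : ℝ in 𝓝[>] 0, ∀ k i : Fin m, (k : ℕ) < r → r ≤ (i : ℕ) →
      2 * P i k k ≤ 1 - ε := by
    rw [eventually_all]; intro k
    rw [eventually_all]; intro i
    by_cases hk : (k : ℕ) < r
    · by_cases hi : r ≤ (i : ℕ)
      · have h := ha k i hk hi
        have hne : i ≠ k := by rintro rfl; omega
        rw [aCoef, if_neg hne] at h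
        have h' : (0 : ℝ) < 1 - 2 * P i k k := by linarith
        filter_upwards [Ioo_mem_nhdsGT h'] with e he _ _
        linarith [he.2]
      · exact Eventually.of_forall fun _ _ h => absurd h hi
    · exact Eventually.of_forall fun _ h => absurd h hk
  obtain ⟨e, h1, h2⟩ := (h.and (Ioo_mem_nhdsGT (zero_lt_one (α := ℝ)))).exists
  exact ⟨e, h2.1, h2.2.le, h1⟩

lemma Q_bound (m ℓ r : ℕ) (hrℓ : r ≤ ℓ) (P : Fin m → Fin m → Fin m → ℝ)
    (hV : IsLVolterra m ℓ P) (ε : ℝ)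
    (hε : ∀ k i : Fin m, (k : ℕ) < r → r ≤ (i : ℕ) → 2 * P i k k ≤ 1 - ε) (i j : Fin m) :
    ∑ k, chi m r k * P i j k ≤ chi m r i * chi m r j +
      (1 - ε) / 2 * (chi m r i * (1 - chi m r j) + chi m r j * (1 - chi m r i)) := by
  obtain ⟨⟨h1, h2, h3⟩, h4, -⟩ := hV
  have single : ∀ a b : Fin m, (a : ℕ) < r → r ≤ (b : ℕ) →
      ∑ k, chi m r k * P b a k = P b a a := by
    intro a b hA hB
    rw [Finset.sum_eq_single a]
    · simp [chi, hA]
    · intro k _ hk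
      by_cases hkr : (k : ℕ) < r
      · rw [h4 b a k (by omega) (by rintro rfl; omega) hk, mul_zero]
      · simp [chi, hkr]
    · simp
  by_cases hi : (i : ℕ) < r <;> by_cases hj : (j : ℕ) < r
  · have : ∑ k, chi m r k * P i j k ≤ ∑ k, P i j k := by
      refine Finset.sum_le_sum fun k _ => ?_
      unfold chi
      split_ifs
      · simp
      · simpa using h1 i j k
    rw [h3] at this
    simpa [chi, hi, hj] using this
  · have := single i j hi (by omega)
    have h5 := hε i j hi (by omega)
    simp_rw [h2 i j]
    rw [this]
    simp [chi, hi, hj]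
    linarith
  · rw [single j i hj (by omega)]
    have h5 := hε j i hj (by omega)
    simp [chi, hi, hj]
    linarith
  · have : ∑ k, chi m r k * P i j k = 0 := by
      refine Finset.sum_eq_zero fun k _ => ?_
      by_cases hkr : (k : ℕ) < r
      · rw [h4 i j k (by omega) (by rintro rfl; omega) (by rintro rfl; omega), mul_zero]
      · simp [chi, hkr]
    rw [this]
    simp [chi, hi, hj]

lemma mass_step (m ℓ r : ℕ) (hrℓ : r ≤ ℓ) (P : Fin m → Fin m → Fin m → ℝ)
    (hV : IsLVolterra m ℓ P) (ε : ℝ)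
    (hε : ∀ k i : Fin m, (k : ℕ) < r → r ≤ (i : ℕ) → 2 * P i k k ≤ 1 - ε)
    (x : Fin m → ℝ) (hx : InSimplex m x) :
    mass m r (QSOmap m P x) ≤ mass m r x * (1 - ε * (1 - mass m r x)) := by
  have e1 : mass m r (QSOmap m P x) = ∑ i, ∑ j, (∑ k, chi m r k * P i j k) * (x i * x j) := by
    unfold mass QSOmap
    simp_rw [Finset.mul_sum, Finset.sum_mul]
    rw [Finset.sum_comm]
    refine Finset.sum_congr rfl fun i _ => ?_
    rw [Finset.sum_comm]
    refine Finset.sum_congr rfl fun j _ => Finset.sum_congr rfl fun k _ => ?_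
    ring
  have e2 : ∑ i, (1 - chi m r i) * x i = 1 - mass m r x := by
    unfold mass
    simp_rw [sub_mul, one_mul]
    rw [Finset.sum_sub_distrib, hx.2]
  calc mass m r (QSOmap m P x) ≤ ∑ i, ∑ j, (chi m r i * chi m r j +
      (1 - ε) / 2 * (chi m r i * (1 - chi m r j) + chi m r j * (1 - chi m r i)))
        * (x i * x j) := by
        rw [e1]
        exact Finset.sum_le_sum fun i _ => Finset.sum_le_sum fun j _ =>
          mul_le_mul_of_nonneg_right (Q_bound m ℓ r hrℓ P hV ε hε i j)
            (mul_nonneg (hx.1 i) (hx.1 j))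
    _ = (∑ i, chi m r i * x i) * (∑ j, chi m r j * x j) + (1 - ε) / 2 *
        ((∑ i, chi m r i * x i) * (∑ j, (1 - chi m r j) * x j) +
          (∑ i, (1 - chi m r i) * x i) * (∑ j, chi m r j * x j)) := by
        simp_rw [Finset.sum_mul_sum, ← Finset.sum_add_distrib, Finset.mul_sum,
          ← Finset.sum_add_distrib]
        refine Finset.sum_congr rfl fun i _ => Finset.sum_congr rfl fun j _ => ?_
        ring
    _ = mass m r x * (1 - ε * (1 - mass m r x)) := by
        rw [e2]
        change mass m r x * mass m r x + (1 - ε) / 2 * (mass m r x * (1 - mass m r x)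
          + (1 - mass m r x) * mass m r x) = _
        ring

lemma chi_nonneg (m r : ℕ) (i : Fin m) : 0 ≤ chi m r i := by
  unfold chi; split_ifs <;> norm_num

/-- under the conditions of Theorem 2, every ω-limit point `x*` of a
trajectory starting in the interior satisfies `x*_1 = ⋯ = x*_r = 0`, i.e. `ω(x⁰)` lies
in the face spanned by `e^{(r+1)}, ..., e^{(m)}`. -/
theorem omega_limit_in_face (m ℓ r : ℕ) (hℓ1 : 1 ≤ ℓ) (hℓm : ℓ ≤ m)
    (hr1 : 1 ≤ r) (hrℓ : r ≤ ℓ) (hrm : r < m)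
    (P : Fin m → Fin m → Fin m → ℝ) (hV : IsLVolterra m ℓ P)
    (ha : ∀ k i : Fin m, (k : ℕ) < r → r ≤ (i : ℕ) → aCoef m P k i < 0)
    (traj : ℕ → (Fin m → ℝ)) (h0 : InIntSimplex m (traj 0))
    (hstep : ∀ n, traj (n + 1) = QSOmap m P (traj n)) :
    ∀ xstar : Fin m → ℝ,
      (∃ φ : ℕ → ℕ, StrictMono φ ∧ Tendsto (fun n => traj (φ n)) atTop (𝓝 xstar)) →
      ∀ i : Fin m, (i : ℕ) < r → xstar i = 0 := by
  intro xstar ⟨φ, hφ, hlim⟩ i hi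
  obtain ⟨ε, hε0, hε1, hε⟩ := exists_eps m r P ha
  have hS : ∀ n, InSimplex m (traj n) := by
    intro n
    induction n with
    | zero => exact ⟨fun i => (h0.1 i).le, h0.2⟩
    | succ n ih => rw [hstep]; exact qso_simplex m P hV.1 _ ih
  have hnn : ∀ n, 0 ≤ mass m r (traj n) := fun n =>
    Finset.sum_nonneg fun i _ => mul_nonneg (chi_nonneg m r i) ((hS n).1 i)
  have hlt : mass m r (traj 0) < 1 := by
    rw [← h0.2]
    refine Finset.sum_lt_sum (fun i _ => ?_) ⟨⟨r, hrm⟩, Finset.mem_univ _, ?_⟩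
    · have := h0.1 i
      unfold chi
      split_ifs <;> linarith
    · simpa [chi] using h0.1 ⟨r, hrm⟩
  set s := mass m r (traj 0) with hs
  have hs0 : 0 ≤ s := hnn 0
  set q := 1 - ε * (1 - s) with hq
  have hq0 : 0 ≤ q := by nlinarith
  have hq1 : q < 1 := by nlinarith
  have hb : ∀ n, mass m r (traj n) ≤ s * q ^ n := by
    intro n
    induction n with
    | zero => simp [hs]
    | succ n ih =>
      have h1 := mass_step m ℓ r hrℓ P hV ε hε _ (hS n)
      rw [← hstep] at h1
      have h2 : mass m r (traj n) ≤ s :=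
        ih.trans (mul_le_of_le_one_right hs0 (pow_le_one₀ hq0 hq1.le))
      calc _ ≤ _ := h1
        _ ≤ mass m r (traj n) * q := by
          refine mul_le_mul_of_nonneg_left ?_ (hnn n)
          rw [hq]; nlinarith
        _ ≤ s * q ^ n * q := mul_le_mul_of_nonneg_right ih hq0
        _ = _ := by ring
  have hz : Tendsto (fun n => traj n i) atTop (𝓝 0) := by
    have hg : Tendsto (fun n => s * q ^ n) atTop (𝓝 0) := by
      simpa using (tendsto_pow_atTop_nhds_zero_of_lt_one hq0 hq1).const_mul s
    refine squeeze_zero (fun n => (hS n).1 i) (fun n => ?_) hg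
    refine le_trans ?_ (hb n)
    have := Finset.single_le_sum (f := fun i => chi m r i * traj n i)
      (fun i _ => mul_nonneg (chi_nonneg m r i) ((hS n).1 i)) (Finset.mem_univ i)
    simpa [chi, hi, mass] using this
  exact tendsto_nhds_unique ((tendsto_pi_nhds.1 hlim) i) (hz.comp hφ.tendsto_atTop)
end

section
/- Let V be an ℓ-Volterra QSO with associated coefficients a_{ki}. Suppose there exist p ∈ {1,...,ℓ} and q ∈ E such that a_{pi} − a_{qi} < 0 (strictly) for every i ∈ E. Then along any trajectory x^{(n+1)} = V(x^{(n)}) remaining in int S^{m-1}, the ratio x_p^{(n)} / x_q^{(n)} → 0 and hence x_p^{(n)} → 0 as n → ∞; consequently every ω-limit point x* of such a trajectory satisfies x*_p = 0. -/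
open Finset Filter Topology

theorem QSO_split (m : ℕ) (P : Fin m → Fin m → Fin m → ℝ) (hQ : IsQSO m P) (k : Fin m)
    (x : Fin m → ℝ) :
    x k * ∑ i, (1 + aCoef m P k i) * x i =
      ∑ i, ∑ j, ((if i = k then P i j k * x i * x j else 0)
        + (if j = k then P i j k * x i * x j else 0)
        - (if i = k then (if j = k then P i j k * x i * x j else 0) else 0)) := by
  have e : ∀ i, (∑ j, ((if i = k then P i j k * x i * x j else 0)
        + (if j = k then P i j k * x i * x j else 0)
        - (if i = k then (if j = k then P i j k * x i * x j else 0) else 0)))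
      = (if i = k then ∑ j, P i j k * x i * x j else 0) + P i k k * x i * x k
        - (if i = k then P i k k * x i * x k else 0) := by
    intro i
    rw [Finset.sum_sub_distrib, Finset.sum_add_distrib]
    by_cases h : i = k <;> simp [h]
  rw [Finset.sum_congr rfl (fun i _ => e i), Finset.sum_sub_distrib, Finset.sum_add_distrib,
    Finset.sum_ite_eq' , Finset.mul_sum]
  simp only [Finset.mem_univ, if_true]
  rw [← Finset.sum_add_distrib, ← Finset.sum_sub_distrib]
  refine Finset.sum_congr rfl fun i _ => ?_
  rw [hQ.2.1 k i k]
  unfold aCoef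
  by_cases h : i = k
  · subst h; simp; ring
  · simp [h]; ring

theorem QSO_ge (m : ℕ) (P : Fin m → Fin m → Fin m → ℝ) (hQ : IsQSO m P) (k : Fin m)
    (x : Fin m → ℝ) (hx : ∀ i, 0 ≤ x i) :
    x k * ∑ i, (1 + aCoef m P k i) * x i ≤ QSOmap m P x k := by
  rw [QSO_split m P hQ]
  unfold QSOmap
  refine Finset.sum_le_sum fun i _ => Finset.sum_le_sum fun j _ => ?_
  have := mul_nonneg (mul_nonneg (hQ.1 i j k) (hx i)) (hx j)
  split_ifs <;> linarith

theorem QSO_eq (m : ℕ) (P : Fin m → Fin m → Fin m → ℝ) (hQ : IsQSO m P) (k : Fin m)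
    (hk : ∀ i j, k ≠ i → k ≠ j → P i j k = 0) (x : Fin m → ℝ) :
    QSOmap m P x k = x k * ∑ i, (1 + aCoef m P k i) * x i := by
  rw [QSO_split m P hQ]
  unfold QSOmap
  refine Finset.sum_congr rfl fun i _ => Finset.sum_congr rfl fun j _ => ?_
  by_cases h : i = k <;> by_cases h' : j = k <;> simp [h, h']
  rw [hk i j (Ne.symm h) (Ne.symm h')]; simp

theorem P_le_one (m : ℕ) (P : Fin m → Fin m → Fin m → ℝ) (hQ : IsQSO m P) (i j k : Fin m) :
    P i j k ≤ 1 := by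
  rw [← hQ.2.2 i j]
  exact Finset.single_le_sum (f := fun k => P i j k) (fun k _ => hQ.1 i j k) (Finset.mem_univ k)

/-- if `a_{pi} - a_{qi} < 0` for all `i`, then along any trajectory in the
interior `x_p^{(n)} / x_q^{(n)} → 0`, hence `x_p^{(n)} → 0`, and every ω-limit point `x*`
satisfies `x*_p = 0`. -/
theorem xp_tendsto_zero (m ℓ : ℕ) (hℓ1 : 1 ≤ ℓ) (hℓm : ℓ ≤ m)
    (P : Fin m → Fin m → Fin m → ℝ) (hV : IsLVolterra m ℓ P)
    (p q : Fin m) (hp : (p : ℕ) < ℓ)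
    (ha : ∀ i : Fin m, aCoef m P p i - aCoef m P q i < 0)
    (traj : ℕ → (Fin m → ℝ)) (hstep : ∀ n, traj (n + 1) = QSOmap m P (traj n))
    (hint : ∀ n, InIntSimplex m (traj n)) :
    Tendsto (fun n => traj n p / traj n q) atTop (𝓝 0) ∧
    Tendsto (fun n => traj n p) atTop (𝓝 0) ∧
    ∀ xstar : Fin m → ℝ,
      (∃ φ : ℕ → ℕ, StrictMono φ ∧ Tendsto (fun n => traj (φ n)) atTop (𝓝 xstar)) →
      xstar p = 0 := by
  obtain ⟨hQ, hvol, -⟩ := hV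
  obtain ⟨i0, -, hi0⟩ := Finset.exists_min_image Finset.univ
    (fun i => aCoef m P q i - aCoef m P p i) ⟨p, Finset.mem_univ p⟩
  set c := aCoef m P q i0 - aCoef m P p i0 with hc
  have hcpos : 0 < c := by have := ha i0; linarith
  have hb0 : ∀ k i, 0 ≤ 1 + aCoef m P k i := by
    intro k i
    have h1 := hQ.1 k k k
    have h2 := hQ.1 i k k
    unfold aCoef
    split_ifs <;> linarith
  have hb2 : ∀ k i, 1 + aCoef m P k i ≤ 2 := by
    intro k i
    have h1 := P_le_one m P hQ k k k
    have h2 := P_le_one m P hQ i k k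
    unfold aCoef
    split_ifs <;> linarith
  have hc2 : c ≤ 2 := by
    have h1 := hb0 p i0
    have h2 := hb2 q i0
    linarith
  have hr0 : ∀ n, 0 ≤ traj n p / traj n q := fun n =>
    (div_pos ((hint n).1 p) ((hint n).1 q)).le
  have hdec : ∀ n, traj (n + 1) p / traj (n + 1) q ≤ (1 - c / 2) * (traj n p / traj n q) := by
    intro n
    obtain ⟨hx, hs⟩ := hint n
    have h1 : traj (n + 1) p = traj n p * ∑ i, (1 + aCoef m P p i) * traj n i := by
      rw [hstep, QSO_eq m P hQ p (fun i j => hvol i j p hp)]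
    have h2 : traj n q * ∑ i, (1 + aCoef m P q i) * traj n i ≤ traj (n + 1) q := by
      rw [hstep]; exact QSO_ge m P hQ q _ (fun i => (hx i).le)
    set A := ∑ i, (1 + aCoef m P p i) * traj n i
    set B := ∑ i, (1 + aCoef m P q i) * traj n i
    have hAB : A + c ≤ B := by
      have : A + c = ∑ i, ((1 + aCoef m P p i) * traj n i + c * traj n i) := by
        rw [Finset.sum_add_distrib, ← Finset.mul_sum, hs, mul_one]
      rw [this]
      refine Finset.sum_le_sum fun i _ => ?_
      have := mul_le_mul_of_nonneg_right (hi0 i (Finset.mem_univ i)) (hx i).le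
      nlinarith
    have hB2 : B ≤ 2 := by
      have : (2 : ℝ) = ∑ i, 2 * traj n i := by rw [← Finset.mul_sum, hs, mul_one]
      rw [this]
      exact Finset.sum_le_sum fun i _ => mul_le_mul_of_nonneg_right (hb2 q i) (hx i).le
    have hA : A ≤ (1 - c / 2) * B := by nlinarith
    rw [div_le_iff₀ ((hint (n + 1)).1 q), h1]
    have hq := hx q
    calc traj n p * A ≤ traj n p * ((1 - c / 2) * B) :=
          mul_le_mul_of_nonneg_left hA (hx p).le
      _ = (1 - c / 2) * (traj n p / traj n q) * (traj n q * B) := by field_simp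
      _ ≤ _ := mul_le_mul_of_nonneg_left h2 (mul_nonneg (by linarith) (hr0 n))
  have hgeo : ∀ n, traj n p / traj n q ≤ (1 - c / 2) ^ n * (traj 0 p / traj 0 q) := by
    intro n
    induction n with
    | zero => simp
    | succ k ih =>
      refine (hdec k).trans ?_
      rw [pow_succ', mul_assoc]
      exact mul_le_mul_of_nonneg_left ih (by linarith)
  have hlim : Tendsto (fun n => traj n p / traj n q) atTop (𝓝 0) := by
    refine squeeze_zero hr0 hgeo ?_
    have := (tendsto_pow_atTop_nhds_zero_of_lt_one (r := 1 - c / 2) (by linarith)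
      (by linarith)).mul_const (traj 0 p / traj 0 q)
    simpa using this
  have hlimp : Tendsto (fun n => traj n p) atTop (𝓝 0) := by
    refine squeeze_zero (fun n => ((hint n).1 p).le) (fun n => ?_) hlim
    obtain ⟨hx, hs⟩ := hint n
    have hq1 : traj n q ≤ 1 := by
      rw [← hs]
      exact Finset.single_le_sum (f := fun i => traj n i) (fun i _ => (hx i).le)
        (Finset.mem_univ q)
    rw [le_div_iff₀ (hx q)]
    exact mul_le_of_le_one_right (hx p).le hq1
  refine ⟨hlim, hlimp, ?_⟩
  rintro xstar ⟨φ, hφ, hx⟩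
  exact tendsto_nhds_unique ((tendsto_pi_nhds.1 hx) p) (hlimp.comp hφ.tendsto_atTop)
end

section
/- Let V be an ℓ-Volterra QSO with associated coefficients a_{ki}, and let X_ℓ = {x ∈ S^{m-1} : V(x)_k = x_k for k = 1,...,ℓ}. If x, y ∈ X_ℓ and supp_ℓ x = supp_ℓ y, where supp_ℓ z = {i ∈ {1,...,ℓ} : z_i ≠ 0}, then λx + (1−λ)y ∈ X_ℓ for every λ ∈ [0,1]. -/
open Finset Filter Topology

theorem QSOmap_factor (m ℓ : ℕ) (P : Fin m → Fin m → Fin m → ℝ) (hV : IsLVolterra m ℓ P)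
    (x : Fin m → ℝ) (k : Fin m) (hk : (k : ℕ) < ℓ) :
    QSOmap m P x k = x k * ∑ i, (2 * P i k k - if i = k then P k k k else 0) * x i := by
  obtain ⟨⟨-, hsym, -⟩, hz, -⟩ := hV
  have h : ∀ i j, P i j k * x i * x j = (if i = k then P j k k * x j * x k else 0)
      + (if j = k then P i k k * x i * x k else 0)
      - (if i = k then (if j = k then P k k k * x k * x k else 0) else 0) := by
    intro i j
    by_cases hi : i = k
    · subst hi
      by_cases hj : j = i
      · subst hj; simp
      · simp [hj, hsym i j i]; ring
    · by_cases hj : j = k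
      · subst hj; simp [hi]
      · simp [hi, hj, hz i j k hk (Ne.symm hi) (Ne.symm hj)]
  unfold QSOmap
  rw [Finset.sum_congr rfl fun i _ => Finset.sum_congr rfl fun j _ => h i j]
  simp only [Finset.sum_sub_distrib, Finset.sum_add_distrib]
  rw [Finset.sum_comm (f := fun i j => if i = k then P j k k * x j * x k else 0)]
  have h3 : ∑ i, ∑ j, (if i = k then (if j = k then P k k k * x k * x k else 0) else 0)
      = P k k k * x k * x k := by
    rw [Finset.sum_comm]
    simp
  rw [h3]
  simp only [Finset.sum_ite_eq', Finset.sum_ite_eq, Finset.mem_univ, if_true, sub_mul,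
    Finset.sum_sub_distrib, ite_mul, zero_mul, mul_sub, Finset.mul_sum]
  rw [← Finset.sum_add_distrib]
  congr 1
  · exact Finset.sum_congr rfl fun i _ => by ring
  · ring

/-- Lemma 2: `X_ℓ` is convex along pairs with equal `ℓ`-support. -/
theorem X_ell_convex (m ℓ : ℕ) (hℓ1 : 1 ≤ ℓ) (hℓm : ℓ ≤ m)
    (P : Fin m → Fin m → Fin m → ℝ) (hV : IsLVolterra m ℓ P)
    (x y : Fin m → ℝ) (hx : InSimplex m x) (hy : InSimplex m y)
    (hxX : ∀ k : Fin m, (k : ℕ) < ℓ → QSOmap m P x k = x k)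
    (hyX : ∀ k : Fin m, (k : ℕ) < ℓ → QSOmap m P y k = y k)
    (hsupp : ∀ i : Fin m, (i : ℕ) < ℓ → (x i ≠ 0 ↔ y i ≠ 0))
    (lam : ℝ) (hl0 : 0 ≤ lam) (hl1 : lam ≤ 1) :
    ∀ k : Fin m, (k : ℕ) < ℓ →
      QSOmap m P (fun i => lam * x i + (1 - lam) * y i) k
        = lam * x k + (1 - lam) * y k := by
  intro k hk
  have h1 := hxX k hk
  have h2 := hyX k hk
  rw [QSOmap_factor m ℓ P hV _ k hk] at h1 h2 ⊢
  by_cases h0 : x k = 0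
  · have h0' : y k = 0 := by
      by_contra hne
      exact (hsupp k hk).2 hne h0
    simp [h0, h0']
  · have h0' := (hsupp k hk).1 h0
    have e1 := mul_left_cancel₀ h0 (h1.trans (mul_one _).symm)
    have e2 := mul_left_cancel₀ h0' (h2.trans (mul_one _).symm)
    have e : ∑ i, (2 * P i k k - if i = k then P k k k else 0)
        * (lam * x i + (1 - lam) * y i) = 1 := by
      calc _ = lam * (∑ i, (2 * P i k k - if i = k then P k k k else 0) * x i)
            + (1 - lam) * (∑ i, (2 * P i k k - if i = k then P k k k else 0) * y i) := by
            rw [Finset.mul_sum, Finset.mul_sum, ← Finset.sum_add_distrib]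
            exact Finset.sum_congr rfl fun i _ => by ring
        _ = 1 := by rw [e1, e2]; ring
    rw [e, mul_one]
end

section
/- Let V be an ℓ-Volterra QSO with associated coefficients a_{ki}, and let p, q, r ∈ E be distinct indices such that: (a) {p,q,r} ∩ {ℓ+1,...,m} contains at most one element, say r; (b) P_{ij,k} = 0 for all i,j ∈ {p,q,r} and all k ∈ {ℓ+1,...,m} \ {p,q,r}; (c) with Δ = (a_{pr}−a_{pp})(a_{qr}−a_{qq}) − (a_{pr}−a_{pq})(a_{qr}−a_{qp}), Δ₁ = a_{qr} a_{pq} − a_{pr} a_{qq}, Δ₂ = a_{pr} a_{qp} − a_{qr} a_{pp}, one has Δ ≠ 0 and sign(Δ) = sign(Δ₁) = sign(Δ₂) = sign(Δ − Δ₁ − Δ₂). Then the relative interior of the two-dimensional face S²_{pqr} of S^{m-1} spanned by the vertices e^{(p)}, e^{(q)}, e^{(r)} contains exactly one fixed point x* of V, given by x*_p = Δ₁/Δ, x*_q = Δ₂/Δ, x*_r = (Δ − Δ₁ − Δ₂)/Δ, and x*_i = 0 for i ∉ {p,q,r}. -/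
open Finset Filter Topology

/-- The candidate fixed point supported on the face spanned by `e^{(p)}, e^{(q)}, e^{(r)}`. -/
def facePoint (m : ℕ) (p q r : Fin m) (A B C : ℝ) : Fin m → ℝ :=
  fun i => if i = p then A else if i = q then B else if i = r then C else 0

theorem sum_three {m : ℕ} (p q r : Fin m) (hpq : p ≠ q) (hpr : p ≠ r) (hqr : q ≠ r)
    (f : Fin m → ℝ) (hf : ∀ i, i ≠ p → i ≠ q → i ≠ r → f i = 0) :
    ∑ i, f i = f p + f q + f r := by
  have h : ∑ i ∈ ({p, q, r} : Finset (Fin m)), f i = ∑ i, f i := by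
    apply Finset.sum_subset (Finset.subset_univ _)
    intro x _ hx
    simp only [Finset.mem_insert, Finset.mem_singleton, not_or] at hx
    exact hf x hx.1 hx.2.1 hx.2.2
  rw [← h, Finset.sum_insert (by simp [hpq, hpr]), Finset.sum_insert (by simp [hqr]),
    Finset.sum_singleton]
  ring

theorem qso_three {m : ℕ} (P : Fin m → Fin m → Fin m → ℝ)
    (p q r : Fin m) (hpq : p ≠ q) (hpr : p ≠ r) (hqr : q ≠ r)
    (y : Fin m → ℝ) (hy : ∀ i, i ≠ p → i ≠ q → i ≠ r → y i = 0) (k : Fin m) :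
    QSOmap m P y k =
      (P p p k * y p * y p + P p q k * y p * y q + P p r k * y p * y r) +
      (P q p k * y q * y p + P q q k * y q * y q + P q r k * y q * y r) +
      (P r p k * y r * y p + P r q k * y r * y q + P r r k * y r * y r) := by
  have h : ∀ i, ∑ j, P i j k * y i * y j =
      P i p k * y i * y p + P i q k * y i * y q + P i r k * y i * y r := by
    intro i
    apply sum_three p q r hpq hpr hqr (fun j => P i j k * y i * y j)
    intro j h1 h2 h3
    simp [hy j h1 h2 h3]
  unfold QSOmap
  simp only [h]
  apply sum_three p q r hpq hpr hqr
    (fun i => P i p k * y i * y p + P i q k * y i * y q + P i r k * y i * y r)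
  intro i h1 h2 h3
  simp [hy i h1 h2 h3]

theorem div_pos_of_sign {a b : ℝ} (ha : a ≠ 0) (h : Real.sign a = Real.sign b) : 0 < b / a := by
  rcases lt_or_gt_of_ne ha with h1 | h1
  · rw [Real.sign_of_neg h1] at h
    rcases lt_trichotomy b 0 with h2 | h2 | h2
    · exact div_pos_of_neg_of_neg h2 h1
    · subst h2; norm_num at h
    · rw [Real.sign_of_pos h2] at h; norm_num at h
  · rw [Real.sign_of_pos h1] at h
    rcases lt_trichotomy b 0 with h2 | h2 | h2
    · rw [Real.sign_of_neg h2] at h; norm_num at h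
    · subst h2; norm_num at h
    · exact div_pos h2 h1

/-- Theorem 7: under conditions (a), (b), (c), the relative interior of the
two-dimensional face `S²_{pqr}` contains exactly one fixed point of `V`, given by
`x*_p = Δ₁/Δ`, `x*_q = Δ₂/Δ`, `x*_r = (Δ - Δ₁ - Δ₂)/Δ`. -/
theorem unique_fixed_point_in_face (m ℓ : ℕ) (hℓ1 : 1 ≤ ℓ) (hℓm : ℓ ≤ m)
    (P : Fin m → Fin m → Fin m → ℝ) (hV : IsLVolterra m ℓ P)
    (p q r : Fin m) (hpq : p ≠ q) (hpr : p ≠ r) (hqr : q ≠ r)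
    (hp : (p : ℕ) < ℓ) (hq : (q : ℕ) < ℓ)
    (hb : ∀ i j k : Fin m, i ∈ ({p, q, r} : Set (Fin m)) → j ∈ ({p, q, r} : Set (Fin m)) →
      ℓ ≤ (k : ℕ) → k ≠ p → k ≠ q → k ≠ r → P i j k = 0)
    (Δ Δ₁ Δ₂ : ℝ)
    (hΔ : Δ = (aCoef m P p r - aCoef m P p p) * (aCoef m P q r - aCoef m P q q)
            - (aCoef m P p r - aCoef m P p q) * (aCoef m P q r - aCoef m P q p))
    (hΔ1 : Δ₁ = aCoef m P q r * aCoef m P p q - aCoef m P p r * aCoef m P q q)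
    (hΔ2 : Δ₂ = aCoef m P p r * aCoef m P q p - aCoef m P q r * aCoef m P p p)
    (hΔ0 : Δ ≠ 0)
    (hsign : Real.sign Δ = Real.sign Δ₁ ∧ Real.sign Δ = Real.sign Δ₂ ∧
             Real.sign Δ = Real.sign (Δ - Δ₁ - Δ₂)) :
    (InSimplex m (facePoint m p q r (Δ₁ / Δ) (Δ₂ / Δ) ((Δ - Δ₁ - Δ₂) / Δ)) ∧
     QSOmap m P (facePoint m p q r (Δ₁ / Δ) (Δ₂ / Δ) ((Δ - Δ₁ - Δ₂) / Δ))
       = facePoint m p q r (Δ₁ / Δ) (Δ₂ / Δ) ((Δ - Δ₁ - Δ₂) / Δ) ∧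
     0 < Δ₁ / Δ ∧ 0 < Δ₂ / Δ ∧ 0 < (Δ - Δ₁ - Δ₂) / Δ) ∧
    (∀ y : Fin m → ℝ, InSimplex m y → (∀ i, i ≠ p → i ≠ q → i ≠ r → y i = 0) →
      0 < y p → 0 < y q → 0 < y r → QSOmap m P y = y →
      y = facePoint m p q r (Δ₁ / Δ) (Δ₂ / Δ) ((Δ - Δ₁ - Δ₂) / Δ)) := by
  obtain ⟨⟨hnn, hsym, hsum⟩, hvol, -⟩ := hV
  have hout : ∀ i j k : Fin m, i ∈ ({p, q, r} : Set (Fin m)) → j ∈ ({p, q, r} : Set (Fin m)) →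
      k ≠ p → k ≠ q → k ≠ r → P i j k = 0 := by
    intro i j k hi hj h1 h2 h3
    by_cases hk : (k : ℕ) < ℓ
    · apply hvol i j k hk
      · rintro rfl; simp_all
      · rintro rfl; simp_all
    · exact hb i j k hi hj (not_lt.mp hk) h1 h2 h3
  have mp : p ∈ ({p, q, r} : Set (Fin m)) := by simp
  have mq : q ∈ ({p, q, r} : Set (Fin m)) := by simp
  have mr : r ∈ ({p, q, r} : Set (Fin m)) := by simp
  have hone : ∀ i j : Fin m, i ∈ ({p, q, r} : Set (Fin m)) → j ∈ ({p, q, r} : Set (Fin m)) →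
      P i j r = 1 - P i j p - P i j q := by
    intro i j hi hj
    have h1 := hsum i j
    rw [sum_three p q r hpq hpr hqr (P i j) (fun k => hout i j k hi hj)] at h1
    linarith
  have app : P p p p = aCoef m P p p + 1 := by simp [aCoef]
  have aqq : P q q q = aCoef m P q q + 1 := by simp [aCoef]
  have apq : P q p p = (aCoef m P p q + 1) / 2 := by simp [aCoef, hpq.symm]
  have apr : P r p p = (aCoef m P p r + 1) / 2 := by simp [aCoef, hpr.symm]
  have aqp : P p q q = (aCoef m P q p + 1) / 2 := by simp [aCoef, hpq]
  have aqr : P r q q = (aCoef m P q r + 1) / 2 := by simp [aCoef, hqr.symm]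
  have z1 : P q q p = 0 := hvol _ _ _ hp hpq hpq
  have z2 : P q r p = 0 := hvol _ _ _ hp hpq hpr
  have z3 : P r q p = 0 := hvol _ _ _ hp hpr hpq
  have z4 : P r r p = 0 := hvol _ _ _ hp hpr hpr
  have w1 : P p p q = 0 := hvol _ _ _ hq hpq.symm hpq.symm
  have w2 : P p r q = 0 := hvol _ _ _ hq hpq.symm hqr
  have w3 : P r p q = 0 := hvol _ _ _ hq hqr hpq.symm
  have w4 : P r r q = 0 := hvol _ _ _ hq hqr hqr
  generalize aCoef m P p p = a at *
  generalize aCoef m P p q = b at *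
  generalize aCoef m P p r = c at *
  generalize aCoef m P q p = d at *
  generalize aCoef m P q q = e at *
  generalize aCoef m P q r = f at *
  -- components of the operator on the face
  have Vp : ∀ y : Fin m → ℝ, (∀ i, i ≠ p → i ≠ q → i ≠ r → y i = 0) → y p + y q + y r = 1 →
      QSOmap m P y p = y p + y p * (a * y p + b * y q + c * y r) := by
    intro y hy hs
    rw [qso_three P p q r hpq hpr hqr y hy, hsym p q p, hsym p r p, z1, z2, z3, z4, app, apq, apr]
    linear_combination y p * hs
  have Vq : ∀ y : Fin m → ℝ, (∀ i, i ≠ p → i ≠ q → i ≠ r → y i = 0) → y p + y q + y r = 1 →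
      QSOmap m P y q = y q + y q * (d * y p + e * y q + f * y r) := by
    intro y hy hs
    rw [qso_three P p q r hpq hpr hqr y hy, hsym q p q, hsym q r q, w1, w2, w3, w4, aqq, aqp, aqr]
    linear_combination y q * hs
  have Vr : ∀ y : Fin m → ℝ, (∀ i, i ≠ p → i ≠ q → i ≠ r → y i = 0) → y p + y q + y r = 1 →
      QSOmap m P y r = 1 - QSOmap m P y p - QSOmap m P y q := by
    intro y hy hs
    rw [qso_three P p q r hpq hpr hqr y hy r, qso_three P p q r hpq hpr hqr y hy p,
      qso_three P p q r hpq hpr hqr y hy q,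
      hone p p mp mp, hone p q mp mq, hone p r mp mr, hone q p mq mp, hone q q mq mq,
      hone q r mq mr, hone r p mr mp, hone r q mr mq, hone r r mr mr]
    linear_combination (y p + y q + y r + 1) * hs
  have Vo : ∀ y : Fin m → ℝ, (∀ i, i ≠ p → i ≠ q → i ≠ r → y i = 0) →
      ∀ k, k ≠ p → k ≠ q → k ≠ r → QSOmap m P y k = 0 := by
    intro y hy k h1 h2 h3
    rw [qso_three P p q r hpq hpr hqr y hy k,
      hout p p k mp mp h1 h2 h3, hout p q k mp mq h1 h2 h3, hout p r k mp mr h1 h2 h3,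
      hout q p k mq mp h1 h2 h3, hout q q k mq mq h1 h2 h3, hout q r k mq mr h1 h2 h3,
      hout r p k mr mp h1 h2 h3, hout r q k mr mq h1 h2 h3, hout r r k mr mr h1 h2 h3]
    ring
  have pos1 := div_pos_of_sign hΔ0 hsign.1
  have pos2 := div_pos_of_sign hΔ0 hsign.2.1
  have pos3 := div_pos_of_sign hΔ0 hsign.2.2
  have hA : Δ * (Δ₁ / Δ) = Δ₁ := by field_simp
  have hB : Δ * (Δ₂ / Δ) = Δ₂ := by field_simp
  have hC : (Δ - Δ₁ - Δ₂) / Δ = 1 - Δ₁ / Δ - Δ₂ / Δ := by field_simp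
  rw [hC] at pos3 ⊢
  generalize Δ₁ / Δ = A at *
  generalize Δ₂ / Δ = B at *
  have xp : facePoint m p q r A B (1 - A - B) p = A := by simp [facePoint]
  have xq : facePoint m p q r A B (1 - A - B) q = B := by simp [facePoint, hpq.symm]
  have xr : facePoint m p q r A B (1 - A - B) r = 1 - A - B := by
    simp [facePoint, hpr.symm, hqr.symm]
  have xo : ∀ i, i ≠ p → i ≠ q → i ≠ r → facePoint m p q r A B (1 - A - B) i = 0 := by
    intro i h1 h2 h3
    simp [facePoint, h1, h2, h3]
  generalize facePoint m p q r A B (1 - A - B) = x at *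
  have xs : x p + x q + x r = 1 := by rw [xp, xq, xr]; ring
  have E1 : a * A + b * B + c * (1 - A - B) = 0 := by
    apply mul_left_cancel₀ hΔ0
    linear_combination (a - c) * hA + (b - c) * hB + c * hΔ + (a - c) * hΔ1 + (b - c) * hΔ2
  have E2 : d * A + e * B + f * (1 - A - B) = 0 := by
    apply mul_left_cancel₀ hΔ0
    linear_combination (d - f) * hA + (e - f) * hB + f * hΔ + (d - f) * hΔ1 + (e - f) * hΔ2
  refine ⟨⟨⟨?_, ?_⟩, ?_, pos1, pos2, pos3⟩, ?_⟩
  · intro i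
    by_cases h1 : i = p
    · rw [h1, xp]; exact pos1.le
    by_cases h2 : i = q
    · rw [h2, xq]; exact pos2.le
    by_cases h3 : i = r
    · rw [h3, xr]; exact pos3.le
    rw [xo i h1 h2 h3]
  · rw [sum_three p q r hpq hpr hqr x xo, xs]
  · have F1 : QSOmap m P x p = x p := by
      rw [Vp x xo xs, xp, xq, xr]; linear_combination A * E1
    have F2 : QSOmap m P x q = x q := by
      rw [Vq x xo xs, xp, xq, xr]; linear_combination B * E2
    funext i
    by_cases h1 : i = p
    · rw [h1, F1]
    by_cases h2 : i = q
    · rw [h2, F2]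
    by_cases h3 : i = r
    · rw [h3, Vr x xo xs, F1, F2]; linarith
    rw [xo i h1 h2 h3, Vo x xo i h1 h2 h3]
  · intro y hy yo yp yq yr hfix
    have ys : y p + y q + y r = 1 := by
      rw [← sum_three p q r hpq hpr hqr y yo]; exact hy.2
    have G1 : a * y p + b * y q + c * y r = 0 := by
      apply mul_left_cancel₀ yp.ne'
      have h := Vp y yo ys
      rw [hfix] at h
      linarith
    have G2 : d * y p + e * y q + f * y r = 0 := by
      apply mul_left_cancel₀ yq.ne'
      have h := Vq y yo ys
      rw [hfix] at h
      linarith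
    have hyr : y r = 1 - y p - y q := by linarith
    rw [hyr] at G1 G2
    have Y1 : y p = A := by
      apply mul_left_cancel₀ hΔ0
      rw [hA, hΔ, hΔ1]
      linear_combination (e - f) * G1 - (b - c) * G2
    have Y2 : y q = B := by
      apply mul_left_cancel₀ hΔ0
      rw [hB, hΔ, hΔ2]
      linear_combination (a - c) * G2 - (d - f) * G1
    funext i
    by_cases h1 : i = p
    · rw [h1, xp, Y1]
    by_cases h2 : i = q
    · rw [h2, xq, Y2]
    by_cases h3 : i = r
    · rw [h3, xr, hyr, Y1, Y2]
    rw [xo i h1 h2 h3, yo i h1 h2 h3]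
end
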